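/- Every Eberlein–Grothendieck, locally compact, scattered space of cardinality ω₁ whose Cantor–Bendixson height is strictly less than the ordinal ω₁·ω₁ is σ-discrete. -/

import Mathlib

open Set Topology Ordinal Cardinal

noncomputable section
universe u

/-- A topological space is *scattered* if every nonempty subset has a point isolated
in the subspace topology, i.e. there is an open set meeting the subset in exactly
that point. -/
def IsScattered (X : Type*) [TopologicalSpace X] : Prop :=
  ∀ S : Set X, S.Nonempty → ∃ x ∈ S, ∃ U : Set X, IsOpen U ∧ U ∩ S = {x}

/-- A space is *meta-Lindelöf* if every open cover has a point-countable open refinement. -/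
def IsMetaLindelof (X : Type*) [TopologicalSpace X] : Prop :=
  ∀ 𝒰 : Set (Set X), (∀ U ∈ 𝒰, IsOpen U) → ⋃₀ 𝒰 = Set.univ →
    ∃ 𝒱 : Set (Set X), (∀ V ∈ 𝒱, IsOpen V) ∧ ⋃₀ 𝒱 = Set.univ ∧
      (∀ V ∈ 𝒱, ∃ U ∈ 𝒰, V ⊆ U) ∧ ∀ x : X, {V ∈ 𝒱 | x ∈ V}.Countable

/-- A space is *hereditarily meta-Lindelöf* if every subspace is meta-Lindelöf. -/
def HereditarilyMetaLindelof (X : Type*) [TopologicalSpace X] : Prop :=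
  ∀ S : Set X, IsMetaLindelof S

/-- A space is *σ-discrete* if it is a countable union of subspaces, each of which is
discrete in its subspace topology. -/
def IsSigmaDiscrete (X : Type*) [TopologicalSpace X] : Prop :=
  ∃ D : ℕ → Set X, (⋃ n, D n) = Set.univ ∧ ∀ n, DiscreteTopology (D n)

/-- The Cantor–Bendixson derivatives `cbDeriv X α = X^(α)`: for each `β < α` we intersect
the set of non-isolated points of `X^(β)`.  This agrees with the usual transfinite
iteration: `X^(0) = X`, `X^(α+1)` is the set of non-isolated points of `X^(α)`, and at
limit ordinals one takes intersections. -/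
def cbDeriv (X : Type*) [TopologicalSpace X] (o : Ordinal) : Set X :=
  ⋂ p : {b : Ordinal // b < o},
    (cbDeriv X p.1 ∩ {x | x ∈ closure (cbDeriv X p.1 \ {x})})
termination_by o
decreasing_by exact p.2

/-- The Cantor–Bendixson height of a space: the least ordinal `α` with `X^(α) = ∅`. -/
def cbHeight (X : Type*) [TopologicalSpace X] : Ordinal :=
  sInf {o : Ordinal | cbDeriv X o = ∅}

/-- A space `X` is *Eberlein–Grothendieck* if it embeds into `C_p(K)`, the space of
continuous real-valued functions on a compact Hausdorff space `K` with the topology of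
pointwise convergence (the subspace topology from the product topology on `K → ℝ`). -/
def EberleinGrothendieck (X : Type u) [TopologicalSpace X] : Prop :=
  ∃ (K : Type u) (_ : TopologicalSpace K), CompactSpace K ∧ T2Space K ∧
    ∃ f : X → {g : K → ℝ // Continuous g}, IsEmbedding f

/-- The weight of a topological space: the least cardinality of a base for the topology. -/
def tweight (X : Type u) [TopologicalSpace X] : Cardinal.{u} :=
  sInf {c : Cardinal.{u} | ∃ B : Set (Set X), TopologicalSpace.IsTopologicalBasis B ∧ #B = c}

/-- A space is *locally countable* if every point has a countable open neighborhood. -/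
def LocallyCountable (X : Type*) [TopologicalSpace X] : Prop :=
  ∀ x : X, ∃ U : Set X, IsOpen U ∧ x ∈ U ∧ U.Countable

lemma countable_adjoin_rat {R : Type*} [CommRing R] [Algebra ℚ R] {s : Set R} (hs : s.Countable) :
    (Algebra.adjoin ℚ s : Set R).Countable := by
  rw [← le_aleph0_iff_set_countable] at hs ⊢
  simpa [hs] using Algebra.lift_cardinalMk_adjoin_le ℚ s

lemma exists_finite_subset_mem_adjoin {R : Type*} [CommRing R] [Algebra ℚ R] {X : Type*}
    {F : X → R} {A : Set X} {q : R} (hq : q ∈ Algebra.adjoin ℚ (F '' A)) :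
    ∃ s ⊆ A, s.Finite ∧ q ∈ Algebra.adjoin ℚ (F '' s) := by
  induction hq using Algebra.adjoin_induction with
  | mem x hx =>
    obtain ⟨a, ha, rfl⟩ := hx
    exact ⟨{a}, by simpa using ha, finite_singleton a, Algebra.subset_adjoin ⟨a, rfl, rfl⟩⟩
  | algebraMap r => exact ⟨∅, empty_subset _, finite_empty, Subalgebra.algebraMap_mem _ r⟩
  | add x y _ _ hx hy =>
    obtain ⟨s, hsA, hs, hxs⟩ := hx
    obtain ⟨t, htA, ht, hyt⟩ := hy
    exact ⟨s ∪ t, union_subset hsA htA, hs.union ht,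
      add_mem (Algebra.adjoin_mono (image_mono subset_union_left) hxs)
        (Algebra.adjoin_mono (image_mono subset_union_right) hyt)⟩
  | mul x y _ _ hx hy =>
    obtain ⟨s, hsA, hs, hxs⟩ := hx
    obtain ⟨t, htA, ht, hyt⟩ := hy
    exact ⟨s ∪ t, union_subset hsA htA, hs.union ht,
      mul_mem (Algebra.adjoin_mono (image_mono subset_union_left) hxs)
        (Algebra.adjoin_mono (image_mono subset_union_right) hyt)⟩

lemma adjoin_real_subset_closure_adjoin_rat {K : Type*} [TopologicalSpace K] [CompactSpace K]
    (S : Set C(K, ℝ)) :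
    (Algebra.adjoin ℝ S : Set C(K, ℝ)) ⊆ closure (Algebra.adjoin ℚ S : Set C(K, ℝ)) := by
  let T := (Algebra.adjoin ℚ S).toSubring.topologicalClosure
  intro q hq
  change q ∈ T
  have hle : (Algebra.adjoin ℚ S).toSubring ≤ T := Subring.le_topologicalClosure _
  induction hq using Algebra.adjoin_induction with
  | mem x hx => exact hle (Algebra.subset_adjoin hx)
  | algebraMap r =>
    have hr : r ∈ closure (range ((↑) : ℚ → ℝ)) := Rat.denseRange_cast r
    have h := image_closure_subset_closure_image
      (continuous_algebraMap ℝ C(K, ℝ)) (mem_image_of_mem _ hr)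
    refine closure_mono ?_ h
    rintro _ ⟨_, ⟨a, rfl⟩, rfl⟩
    have h : algebraMap ℝ C(K, ℝ) (a : ℝ) = algebraMap ℚ C(K, ℝ) a := by
      ext
      simp
    rw [h]
    exact (Algebra.adjoin ℚ S).algebraMap_mem a
  | add x y _ _ hx hy => exact add_mem hx hy
  | mul x y _ _ hx hy => exact mul_mem hx hy

/-- A version of the Stone–Weierstrass theorem for families that need not separate points. -/
lemma mem_closure_adjoin_rat {K : Type*} [TopologicalSpace K] [CompactSpace K]
    {S : Set C(K, ℝ)} {g : C(K, ℝ)}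
    (hg : ∀ k k', (∀ s ∈ S, s k = s k') → g k = g k') :
    g ∈ closure (Algebra.adjoin ℚ S : Set C(K, ℝ)) := by
  let r : Setoid K :=
    { r := fun k k' => ∀ s ∈ S, s k = s k'
      iseqv := ⟨fun _ _ _ => rfl, fun h s hs => (h s hs).symm,
        fun h h' s hs => (h s hs).trans (h' s hs)⟩ }
  let π : C(K, Quotient r) := ⟨Quotient.mk r, continuous_quotient_mk'⟩
  have lift : ∀ h : C(K, ℝ), (∀ k k', (∀ s ∈ S, s k = s k') → h k = h k') →
      ∃ h' : C(Quotient r, ℝ), h'.comp π = h := fun h hh =>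
    ⟨⟨Quotient.lift h hh, h.continuous.quotient_lift hh⟩, by ext; rfl⟩
  let Φ : C(Quotient r, ℝ) →ₐ[ℝ] C(K, ℝ) := ContinuousMap.compRightAlgHom ℝ ℝ π
  have hΦ : Continuous Φ := ContinuousMap.continuous_precomp π
  let B : Subalgebra ℝ C(Quotient r, ℝ) := (Algebra.adjoin ℝ S).comap Φ
  have hB : B.SeparatesPoints := by
    intro x y
    induction x, y using Quotient.inductionOn₂ with
    | h k k' =>
      intro hne
      have : ¬ ∀ s ∈ S, s k = s k' := fun h => hne (Quotient.sound h)
      push Not at this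
      obtain ⟨s, hs, hsk⟩ := this
      obtain ⟨s', hs'⟩ := lift s fun _ _ h => h s hs
      refine ⟨s', ⟨s', ?_, rfl⟩, ?_⟩
      · change s'.comp π ∈ Algebra.adjoin ℝ S
        rw [hs']
        exact Algebra.subset_adjoin hs
      · rw [← hs'] at hsk
        exact hsk
  obtain ⟨g', hg'⟩ := lift g hg
  have h := ContinuousMap.continuousMap_mem_subalgebra_closure_of_separatesPoints B hB g'
  have h' : Φ g' ∈ closure (Algebra.adjoin ℝ S : Set C(K, ℝ)) :=
    map_mem_closure hΦ h fun _ hx => hx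
  rw [show Φ g' = g from hg'] at h'
  exact closure_minimal (adjoin_real_subset_closure_adjoin_rat S) isClosed_closure h'

/-- `A` is closed under the set-valued operation `Φ` on its nonempty finite subsets. -/
def FinitelyClosed {X : Type*} (Φ : Set X → Set X) (A : Set X) : Prop :=
  ∀ s ⊆ A, s.Finite → s.Nonempty → Φ s ⊆ A

lemma exists_countable_finitelyClosed {X : Type*} {Φ : Set X → Set X}
    (hΦ : ∀ s, s.Finite → (Φ s).Countable) {A : Set X} (hA : A.Countable) :
    ∃ B, A ⊆ B ∧ B.Countable ∧ FinitelyClosed Φ B := by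
  let step : Set X → Set X := fun B => B ∪ ⋃ s ∈ {s : Set X | s.Finite ∧ s ⊆ B}, Φ s
  let C : ℕ → Set X := fun n => step^[n] A
  have hC : ∀ n, C (n + 1) = step (C n) := fun n => Function.iterate_succ_apply' step n A
  have hmono : Monotone C := monotone_nat_of_le_succ fun n => by
    rw [hC]
    exact subset_union_left
  refine ⟨⋃ n, C n, subset_iUnion C 0, countable_iUnion fun n => ?_, ?_⟩
  · induction n with
    | zero => exact hA
    | succ n ih =>
      rw [hC]
      exact ih.union ((countable_ofPred_finite_subset ih).biUnion fun s hs => hΦ s hs.1)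
  · intro s hs hsf _
    obtain ⟨n, hn⟩ := hmono.directed_le.exists_mem_subset_of_finset_subset_biUnion
      (s := hsf.toFinset) (by simpa using hs)
    have hn' : s ⊆ C n := by simpa using hn
    refine Subset.trans ?_ (subset_iUnion C (n + 1))
    rw [hC]
    exact (subset_biUnion_of_mem (u := Φ) (show s ∈ {s : Set X | s.Finite ∧ s ⊆ C n} from
      ⟨hsf, hn'⟩)).trans subset_union_right

lemma exists_filtration {X : Type u} (hX : #X ≤ ℵ₁) {Φ : Set X → Set X}
    (hΦ : ∀ s, s.Finite → (Φ s).Countable) :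
    ∃ ρ : X → Ordinal.{u}, (∀ x, {y | ρ y ≤ ρ x}.Countable) ∧
      ∀ α, FinitelyClosed Φ {x | ρ x < α} := by
  obtain ⟨r, hr, hord⟩ := Cardinal.exists_ord_eq X
  let i : X → Ordinal.{u} := typein r
  have hi : ∀ x, {y | i y ≤ i x}.Countable := by
    intro x
    have h1 : {y | r y x}.Countable := by
      rw [← le_aleph0_iff_set_countable, ← lt_aleph_one_iff]
      have : #{y | r y x} = (i x).card := card_typein x
      rw [this]
      exact (card_typein_lt x hord).trans_le hX
    refine (h1.insert x).mono fun y hy => ?_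
    rcases (show i y ≤ i x from hy).eq_or_lt with h | h
    · exact Or.inl (typein_injective r h)
    · exact Or.inr ((typein_lt_typein r).1 h)
  let cl : Ordinal.{u} → Set X := fun α => ⋂₀ {B | {y | i y ≤ α} ⊆ B ∧ FinitelyClosed Φ B}
  have hcl_sub : ∀ α, {y | i y ≤ α} ⊆ cl α := fun α => subset_sInter fun B hB => hB.1
  have hcl_closed : ∀ α, FinitelyClosed Φ (cl α) := fun α s hs hsf hsn =>
    subset_sInter fun B hB => hB.2 s (hs.trans (sInter_subset_of_mem hB)) hsf hsn
  have hcl_mono : Monotone cl := fun α β h => sInter_subset_sInter fun B hB =>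
    ⟨Subset.trans (fun y (hy : i y ≤ α) => hy.trans h) hB.1, hB.2⟩
  have hcl_countable : ∀ x, (cl (i x)).Countable := by
    intro x
    obtain ⟨B, hAB, hB, hBc⟩ := exists_countable_finitelyClosed hΦ (hi x)
    exact hB.mono (sInter_subset_of_mem ⟨hAB, hBc⟩)
  let ρ : X → Ordinal.{u} := fun x => sInf {α | x ∈ cl α}
  have hρi : ∀ x, ρ x ≤ i x := fun x => csInf_le' (hcl_sub (i x) (le_refl (i x)))
  have hρ : ∀ x, x ∈ cl (ρ x) := fun x =>
    csInf_mem (s := {α | x ∈ cl α}) ⟨i x, hcl_sub (i x) (le_refl (i x))⟩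
  refine ⟨ρ, fun x => ?_, fun α s hs hsf hsn => ?_⟩
  · exact (hcl_countable x).mono fun y hy => hcl_mono (le_trans hy (hρi x)) (hρ y)
  · obtain ⟨m, hm, hmax⟩ := exists_max_image s ρ hsf hsn
    have h := hcl_closed (ρ m) s (fun y hy => hcl_mono (hmax y hy) (hρ y)) hsf hsn
    intro y hy
    have hle : ρ y ≤ ρ m := csInf_le' (h hy)
    exact hle.trans_lt (hs hm)

lemma IsScattered.exists_rank {X : Type u} [TopologicalSpace X] (hsc : IsScattered X) :
    ∃ h : X → Ordinal.{u}, ∀ x, ∃ U, IsOpen U ∧ x ∈ U ∧ ∀ y ∈ U, y ≠ x → h y < h x := by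
  let step : Set X → Set X := fun O => O ∪ {x | ∃ U, IsOpen U ∧ x ∈ U ∧ U ⊆ insert x O}
  have hstep : ∀ O, IsOpen O → IsOpen (step O) := by
    intro O hO
    rw [isOpen_iff_forall_mem_open]
    rintro x (hx | ⟨U, hU, hxU, hUO⟩)
    · exact ⟨O, subset_union_left, hO, hx⟩
    · refine ⟨U, fun y hy => ?_, hU, hxU⟩
      rcases hUO hy with rfl | h
      · exact Or.inr ⟨U, hU, hxU, hUO⟩
      · exact Or.inl h
  let F : Ordinal.{u} → Set X := WellFounded.fix (C := fun _ => Set X) Ordinal.lt_wf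
    fun o ih => step (⋃ b, ⋃ hb : b < o, ih b hb)
  have hF : ∀ o, F o = step (⋃ b, ⋃ _ : b < o, F b) := fun o => WellFounded.fix_eq _ _ o
  have hex : ∀ x, ∃ o, x ∈ F o := by
    by_contra! hne
    obtain ⟨x, hx⟩ := hne
    have hnew : ∀ o, ∃ y ∈ F o, ∀ b < o, y ∉ F b := by
      intro o
      obtain ⟨y, hy, U, hU, hUS⟩ := hsc (⋃ b, ⋃ _ : b < o, F b)ᶜ ⟨x, by simp [hx]⟩
      refine ⟨y, ?_, by simpa using hy⟩
      rw [hF]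
      refine Or.inr ⟨U, hU, (hUS.ge rfl).1, fun z hz => ?_⟩
      by_cases hzO : z ∈ ⋃ b, ⋃ _ : b < o, F b
      · exact Or.inr hzO
      · exact Or.inl (hUS.le ⟨hz, hzO⟩)
    choose g hgF hg using hnew
    refine not_injective_of_ordinal g fun a b hab => ?_
    by_contra hne
    rcases lt_or_gt_of_ne hne with h | h
    · exact hg b a h (hab ▸ hgF a)
    · exact hg a b h (hab ▸ hgF b)
  refine ⟨fun x => sInf {o | x ∈ F o}, fun x => ?_⟩
  have hx : x ∈ F (sInf {o | x ∈ F o}) := csInf_mem (s := {o | x ∈ F o}) (hex x)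
  rw [hF] at hx
  rcases hx with hx | ⟨U, hU, hxU, hUO⟩
  · simp only [mem_iUnion] at hx
    obtain ⟨b, hb, hxb⟩ := hx
    exact absurd (csInf_le' (show b ∈ {o | x ∈ F o} from hxb)) (not_le.2 hb)
  · refine ⟨U, hU, hxU, fun y hy hyx => ?_⟩
    have hyO := (hUO hy).resolve_left hyx
    simp only [mem_iUnion] at hyO
    obtain ⟨b, hb, hyb⟩ := hyO
    exact lt_of_le_of_lt (csInf_le' hyb) hb

lemma IsScattered.totallyDisconnectedSpace {X : Type*} [TopologicalSpace X] [T1Space X]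
    (hsc : IsScattered X) : TotallyDisconnectedSpace X := by
  refine ⟨fun S _ hS => ?_⟩
  rcases S.eq_empty_or_nonempty with rfl | hne
  · exact subsingleton_empty
  obtain ⟨x, hx, U, hU, hUS⟩ := hsc S hne
  have hxU : x ∈ U := (hUS.ge rfl).1
  suffices S ⊆ {x} from subsingleton_singleton.anti this
  by_contra hcon
  obtain ⟨y, hy, hyx⟩ := not_subset.1 hcon
  obtain ⟨z, hzS, hzU, hzx⟩ := hS U {x}ᶜ hU isOpen_compl_singleton
    (fun z _ => by
      by_cases h : z = x
      · exact Or.inl (h ▸ hxU)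
      · exact Or.inr h) ⟨x, hx, hxU⟩ ⟨y, hy, hyx⟩
  exact hzx (hUS.le ⟨hzU, hzS⟩)

lemma exists_closing_operation {X K : Type*} [TopologicalSpace X] [TopologicalSpace K]
    [CompactSpace K] {F : X → C(K, ℝ)} (hF : ∀ k, Continuous fun x => F x k) {ε : X → ℝ}
    (hε : ∀ x, 0 < ε x) (hsep : ∀ x y, dist (F x) (F y) < ε x → dist (F x) (F y) < ε y → x = y) :
    ∃ Φ : Set X → Set X, (∀ s, s.Finite → (Φ s).Countable) ∧
      ∀ A, FinitelyClosed Φ A → IsClosed A := by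
  let near : C(K, ℝ) → ℕ → Set X := fun q n =>
    {y | 1 / ((n : ℝ) + 1) ≤ ε y ∧ dist (F y) q < 1 / ((n : ℝ) + 1) / 2}
  have hnear : ∀ q n, (near q n).Subsingleton := by
    rintro q n y ⟨hy, hyq⟩ z ⟨hz, hzq⟩
    have := dist_triangle_right (F y) (F z) q
    exact hsep y z (by linarith) (by linarith)
  refine ⟨fun s => ⋃ q ∈ (Algebra.adjoin ℚ (F '' s) : Set C(K, ℝ)), ⋃ n, near q n,
    fun s hs => (countable_adjoin_rat (hs.image F).countable).biUnion fun q _ =>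
      countable_iUnion fun n => (hnear q n).countable, fun A hA => ?_⟩
  refine isClosed_of_closure_subset fun y hy => ?_
  obtain ⟨a, ha⟩ : A.Nonempty := closure_nonempty_iff.1 ⟨y, hy⟩
  have hcl : F y ∈ closure (Algebra.adjoin ℚ (F '' A) : Set C(K, ℝ)) := by
    refine mem_closure_adjoin_rat fun k k' h => ?_
    have hsub : A ⊆ {x | F x k = F x k'} := fun x hx => h _ (mem_image_of_mem F hx)
    exact closure_minimal hsub (isClosed_eq (hF k) (hF k')) hy
  obtain ⟨n, hn⟩ := exists_nat_one_div_lt (hε y)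
  obtain ⟨q, hq, hyq⟩ := Metric.mem_closure_iff.1 hcl (1 / ((n : ℝ) + 1) / 2) (by positivity)
  obtain ⟨s, hsA, hs, hqs⟩ := exists_finite_subset_mem_adjoin hq
  refine hA (insert a s) (insert_subset ha hsA) (hs.insert a) (insert_nonempty a s) ?_
  simp only [mem_iUnion]
  exact ⟨q, Algebra.adjoin_mono (image_mono (subset_insert a s)) hqs, n, hn.le, hyq⟩

lemma isSigmaDiscrete_of_coloring {X : Type*} [TopologicalSpace X] {V : X → Set X}
    (hVo : ∀ x, IsOpen (V x)) (hVmem : ∀ x, x ∈ V x)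
    (hVsymm : ∀ x y, x ∈ V y → y ∈ V x → x = y) {c : X → ℕ}
    (hc : ∀ x n, {y | x ∈ V y ∧ c y = n}.Finite) : IsSigmaDiscrete X := by
  let m : X → ℕ := fun x => {y | x ∈ V y ∧ c y = c x}.ncard
  refine ⟨fun k => {x | Nat.pair (c x) (m x) = k}, ?_, fun k => ?_⟩
  · exact eq_univ_of_forall fun x => mem_iUnion.2 ⟨Nat.pair (c x) (m x), rfl⟩
  · rw [discreteTopology_subtype_iff']
    intro x hx
    refine ⟨⋂ y ∈ {y | x ∈ V y ∧ c y = c x}, V y,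
      (hc x (c x)).isOpen_biInter fun y _ => hVo y, ?_⟩
    refine Subset.antisymm ?_ ?_
    · rintro w ⟨hw, hwk⟩
      obtain ⟨hcw, hmw⟩ := Nat.pair_eq_pair.1 (hwk.trans hx.symm)
      have hsub : {y | x ∈ V y ∧ c y = c x} ⊆ {y | w ∈ V y ∧ c y = c w} := fun y hy =>
        ⟨mem_iInter₂.1 hw y hy, hy.2.trans hcw.symm⟩
      have heq := eq_of_subset_of_ncard_le hsub hmw.le (hc w (c w))
      have hxw : w ∈ {y | x ∈ V y ∧ c y = c x} := heq.ge ⟨hVmem w, rfl⟩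
      exact hVsymm w x (mem_iInter₂.1 hw x ⟨hVmem x, rfl⟩) hxw.1
    · rintro _ rfl
      exact ⟨mem_iInter₂.2 fun y hy => hy.1, hx⟩

lemma isSigmaDiscrete_of_pointCountable {X : Type u} [TopologicalSpace X] [T2Space X]
    (hX : #X ≤ ℵ₁) {Φ : Set X → Set X} (hΦ : ∀ s, s.Finite → (Φ s).Countable)
    (hΦcl : ∀ A, FinitelyClosed Φ A → IsClosed A) {V : X → Set X}
    (hVo : ∀ x, IsOpen (V x)) (hVc : ∀ x, IsCompact (V x)) (hVmem : ∀ x, x ∈ V x)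
    (hVsymm : ∀ x y, x ∈ V y → y ∈ V x → x = y) (hVcount : ∀ x, {y | x ∈ V y}.Countable) :
    IsSigmaDiscrete X := by
  let G : Set X → Set X → Set X := fun b a => (⋂ y ∈ b, V y) ∩ ⋂ y ∈ a, (V y)ᶜ
  have hpick : ∀ b a, ∃ p : Set X, p.Subsingleton ∧ ((G b a).Nonempty → (p ∩ G b a).Nonempty) := by
    intro b a
    rcases (G b a).eq_empty_or_nonempty with h | ⟨x, hx⟩
    · exact ⟨∅, subsingleton_empty, by simp [h]⟩
    · exact ⟨{x}, subsingleton_singleton, fun _ => ⟨x, rfl, hx⟩⟩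
  choose pick hpick_sub hpick using hpick
  let Ψ : Set X → Set X := fun s =>
    (Φ s ∪ ⋃ x ∈ s, {y | x ∈ V y}) ∪ ⋃ b ∈ 𝒫 s, ⋃ a ∈ 𝒫 s, pick b a
  have hΨ : ∀ s, s.Finite → (Ψ s).Countable := fun s hs =>
    ((hΦ s hs).union (hs.countable.biUnion fun x _ => hVcount x)).union
      (hs.powerset.countable.biUnion fun b _ => hs.powerset.countable.biUnion fun a _ =>
        (hpick_sub b a).countable)
  have hΨΦ : ∀ A, FinitelyClosed Ψ A → IsClosed A := fun A hA =>
    hΦcl A fun s hs hsf hsn => (subset_union_left.trans subset_union_left).trans (hA s hs hsf hsn)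
  have hΨN : ∀ A, FinitelyClosed Ψ A → ∀ x ∈ A, ∀ y, x ∈ V y → y ∈ A := fun A hA x hx y hxy =>
    hA {x} (singleton_subset_iff.2 hx) (finite_singleton x) (singleton_nonempty x)
      (Or.inl (Or.inr (by simpa using hxy)))
  -- the trace on a closed set of the neighbourhoods of a point is realised by a point of the set
  have htrace : ∀ A, FinitelyClosed Ψ A → ∀ x, ∀ y₀ ∈ A, x ∈ V y₀ →
      ∃ z ∈ A, ∀ y, z ∈ V y ↔ y ∈ A ∧ x ∈ V y := by
    intro A hA x y₀ hy₀ hx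
    have hcomp : IsCompact (V y₀ ∩ A) := (hVc y₀).inter_right (hΨΦ A hA)
    let t : A → Set X := fun y => {w | w ∈ V y ↔ x ∈ V y}
    have ht : ∀ y, IsClosed (t y) := by
      intro y
      by_cases h : x ∈ V y
      · simpa [t, h] using (hVc (y : X)).isClosed
      · simpa [t, h, compl_def] using (hVo (y : X)).isClosed_compl
    obtain ⟨z, ⟨-, hzA⟩, hz⟩ := hcomp.inter_iInter_nonempty t ht fun u => by
      let s : Set X := insert y₀ (Subtype.val '' (u : Set A))
      have hsA : s ⊆ A := by
        rintro w (rfl | ⟨v, -, rfl⟩)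
        · exact hy₀
        · exact v.2
      have hxG : x ∈ G {y ∈ s | x ∈ V y} {y ∈ s | x ∉ V y} := by
        simp +contextual [G]
      obtain ⟨p, hp, hpG⟩ := hpick _ _ ⟨x, hxG⟩
      have hpA : p ∈ A := by
        refine hA s hsA ((u.finite_toSet.image _).insert y₀) (insert_nonempty _ _) (Or.inr ?_)
        simp only [mem_iUnion]
        exact ⟨_, sep_subset _ _, _, sep_subset _ _, hp⟩
      have hps : ∀ y ∈ s, (p ∈ V y ↔ x ∈ V y) := by
        intro y hy
        by_cases h : x ∈ V y
        · exact iff_of_true (mem_iInter₂.1 hpG.1 y ⟨hy, h⟩) h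
        · exact iff_of_false (mem_iInter₂.1 hpG.2 y ⟨hy, h⟩) h
      exact ⟨p, ⟨(hps y₀ (mem_insert _ _)).2 hx, hpA⟩, mem_iInter₂.2 fun y hy =>
        hps y (Or.inr ⟨y, hy, rfl⟩)⟩
    refine ⟨z, hzA, fun y => ⟨fun hy => ?_, fun hy => ?_⟩⟩
    · have hyA := hΨN A hA z hzA y hy
      exact ⟨hyA, (mem_iInter.1 hz ⟨y, hyA⟩).1 hy⟩
    · exact (mem_iInter.1 hz ⟨y, hy.1⟩).2 hy.2
  obtain ⟨ρ, hρ, hρc⟩ := exists_filtration hX hΨ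
  have hfib : ∀ α, ∃ g : X → ℕ, InjOn g {y | ρ y = α} := by
    intro α
    rw [← countable_iff_exists_injOn]
    rcases {y | ρ y = α}.eq_empty_or_nonempty with h | ⟨x, rfl⟩
    · rw [h]
      exact countable_empty
    · exact (hρ x).mono fun y hy => le_of_eq hy
  choose g hg using hfib
  refine isSigmaDiscrete_of_coloring hVo hVmem hVsymm (c := fun y => g (ρ y) y) fun x n => ?_
  by_contra hinf
  have : Infinite {y | x ∈ V y ∧ g (ρ y) y = n} := infinite_coe_iff.2 hinf
  let e := Infinite.natEmbedding {y | x ∈ V y ∧ g (ρ y) y = n}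
  have hρe : Function.Injective fun i => ρ (e i) := by
    intro i j hij
    have hij' : ρ (e i) = ρ (e j) := hij
    refine e.injective (Subtype.ext (hg _ hij' rfl ?_))
    have hi := (e i).2.2
    rw [hij'] at hi
    exact hi.trans (e j).2.2.symm
  obtain ⟨k, hk | hk⟩ := exists_increasing_or_nonincreasing_subseq (· < ·) fun i => ρ (e i)
  · let A : Set X := ⋃ i, {w | ρ w < ρ (e (k i))}
    have hmono : Monotone fun i => {w | ρ w < ρ (e (k i))} :=
      monotone_nat_of_le_succ fun i w hw => lt_trans hw (hk i (i + 1) i.lt_succ_self)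
    have hA : FinitelyClosed Ψ A := by
      intro s hs hsf hsn
      obtain ⟨i, hi⟩ := hmono.directed_le.exists_mem_subset_of_finset_subset_biUnion
        (s := hsf.toFinset) (by simpa using hs)
      exact (hρc _ s (by simpa using hi) hsf hsn).trans
        (subset_iUnion (fun i => {w | ρ w < ρ (e (k i))}) i)
    have hmem : ∀ i, (e (k i) : X) ∈ A := fun i =>
      mem_iUnion.2 ⟨i + 1, hk i (i + 1) i.lt_succ_self⟩
    obtain ⟨z, hzA, hz⟩ := htrace A hA x _ (hmem 0) (e (k 0)).2.1
    obtain ⟨i, hi⟩ := mem_iUnion.1 hzA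
    have hlt : (e (k i) : X) ∈ {w | ρ w < ρ (e (k i))} :=
      hΨN _ (hρc _) z hi _ ((hz _).2 ⟨hmem i, (e (k i)).2.1⟩)
    exact lt_irrefl (ρ (e (k i))) hlt
  · refine not_strictAnti_of_wellFoundedLT (fun i => ρ (e (k i))) fun i j hij => ?_
    exact lt_of_le_of_ne (not_lt.1 (hk i j hij)) fun h => hij.ne' (k.injective (hρe h))

/-- A locally compact scattered Eberlein–Grothendieck space of cardinality at most `ℵ₁` is
σ-discrete, whatever its Cantor–Bendixson height. -/
theorem EberleinGrothendieck.isSigmaDiscrete {X : Type u} [TopologicalSpace X]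
    [LocallyCompactSpace X] (hEG : EberleinGrothendieck X) (hsc : IsScattered X) (hX : #X ≤ ℵ₁) :
    IsSigmaDiscrete X := by
  obtain ⟨K, _, _, _, f, hf⟩ := hEG
  have : T2Space X := hf.t2Space
  have : TotallyDisconnectedSpace X := hsc.totallyDisconnectedSpace
  obtain ⟨h, hh⟩ := hsc.exists_rank
  choose U hUo hxU hUh using hh
  let F : X → C(K, ℝ) := fun x => ⟨(f x).1, (f x).2⟩
  have hF : ∀ k, Continuous fun x => F x k := fun k =>
    (continuous_apply k).comp (continuous_subtype_val.comp hf.continuous)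
  have hball : ∀ x, ∃ ε > 0, ∀ y, dist (F y) (F x) < ε → y ∈ U x := by
    intro x
    obtain ⟨O, hO, hOU⟩ := hf.isInducing.isOpen_iff.1 (hUo x)
    let ι : C(K, ℝ) → {g : K → ℝ // Continuous g} := fun g => ⟨g, g.continuous⟩
    have hι : Continuous ι :=
      Continuous.subtype_mk (continuous_pi fun k => continuous_eval_const k) _
    have hmem : F x ∈ ι ⁻¹' O := by
      change x ∈ f ⁻¹' O
      rw [hOU]
      exact hxU x
    obtain ⟨ε, hε, hεO⟩ := Metric.isOpen_iff.1 (hO.preimage hι) _ hmem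
    refine ⟨ε, hε, fun y hy => ?_⟩
    rw [← hOU]
    exact hεO hy
  choose ε hε hball using hball
  have hUsymm : ∀ x y, x ∈ U y → y ∈ U x → x = y := by
    intro x y hxy hyx
    by_contra hne
    exact lt_asymm (hUh y x hxy hne) (hUh x y hyx (Ne.symm hne))
  obtain ⟨Φ, hΦ, hΦcl⟩ := exists_closing_operation hF hε fun x y hx hy =>
    hUsymm x y (hball y x hy) (hball x y (by rwa [dist_comm]))
  obtain ⟨ρ, hρ, hρc⟩ := exists_filtration hX hΦ
  have hV : ∀ x, ∃ V, IsOpen V ∧ IsCompact V ∧ x ∈ V ∧ V ⊆ U x ∩ {y | ρ y < ρ x}ᶜ := by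
    intro x
    obtain ⟨C, hC, hxC⟩ := exists_compact_mem_nhds x
    have hnhds : interior C ∩ (U x ∩ {y | ρ y < ρ x}ᶜ) ∈ 𝓝 x :=
      Filter.inter_mem (interior_mem_nhds.2 hxC) (((hUo x).inter
        (hΦcl _ (hρc _)).isOpen_compl).mem_nhds ⟨hxU x, lt_irrefl (ρ x)⟩)
    obtain ⟨V, hVclopen, hxV, hVsub⟩ :=
      loc_compact_Haus_tot_disc_of_zero_dim.mem_nhds_iff.1 hnhds
    exact ⟨V, hVclopen.isOpen, hC.of_isClosed_subset hVclopen.isClosed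
      (hVsub.trans (inter_subset_left.trans interior_subset)), hxV,
      hVsub.trans inter_subset_right⟩
  choose V hVo hVc hxV hVsub using hV
  exact isSigmaDiscrete_of_pointCountable hX hΦ hΦcl hVo hVc hxV
    (fun x y hxy hyx => hUsymm x y (hVsub y hxy).1 (hVsub x hyx).1)
    fun x => (hρ x).mono fun y hy => by
      have h : ¬ ρ x < ρ y := (hVsub y hy).2
      exact not_lt.1 h

/-- Every Eberlein–Grothendieck, locally compact, scattered space of cardinality `ω₁`
whose Cantor–Bendixson height is strictly less than `ω₁ · ω₁` is σ-discrete. -/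
theorem sigmaDiscrete_of_EG_locallyCompact_scattered
    (X : Type u) [TopologicalSpace X] [LocallyCompactSpace X]
    (hEG : EberleinGrothendieck X) (hsc : IsScattered X)
    (hcard : #X = Cardinal.aleph 1)
    (hht : cbHeight X < ω₁ * ω₁) :
    IsSigmaDiscrete X := by
  exact hEG.isSigmaDiscrete hsc hcard.le
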